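/- arXiv:2201.06970 — 7 statements merged into one kernel-verified Lean document; each statement's English description precedes it below -/
import Mathlib

section
/- Let α > 0 be a real constant and let ℓ ≥ 0 be an integer. Then the function x ↦ (Γ(x+α+ℓ)/(Γ(α+1)·Γ(x+ℓ))) · (ζ(x+α)/ζ(x)) is strictly increasing in x on the interval (1, ∞). -/
/-- The Riemann zeta function for real `x > 1`, given by `ζ(x) = Σ_{k=1}^∞ 1/k^x`. -/
noncomputable def zeta (x : ℝ) : ℝ := ∑' n : ℕ, 1 / (n + 1 : ℝ) ^ x

open Real in
/-- The log-convexity of `Γ` in product form. -/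
theorem Gamma_add_mul_Gamma_le {x y α : ℝ} (hx : 0 < x) (hxy : x < y) (hα : 0 < α) :
    Gamma (x + α) * Gamma y ≤ Gamma x * Gamma (y + α) := by
  have hd : 0 < y + α - x := by linarith
  set a := (y - x) / (y + α - x) with ha
  set b := α / (y + α - x) with hb
  have ha0 : 0 < a := div_pos (by linarith) hd
  have hb0 : 0 < b := div_pos hα hd
  have hab : a + b = 1 := by rw [ha, hb]; field_simp; ring
  have hy : 0 < y + α := by linarith
  have h₁ := Gamma_mul_add_mul_le_rpow_Gamma_mul_rpow_Gamma hx hy ha0 hb0 hab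
  have h₂ := Gamma_mul_add_mul_le_rpow_Gamma_mul_rpow_Gamma hx hy hb0 ha0 (by linarith)
  have e₁ : a * x + b * (y + α) = x + α := by rw [ha, hb]; field_simp; ring
  have e₂ : b * x + a * (y + α) = y := by rw [ha, hb]; field_simp; ring
  rw [e₁] at h₁
  rw [e₂] at h₂
  have gx := Gamma_pos_of_pos hx
  have gy := Gamma_pos_of_pos hy
  calc Gamma (x + α) * Gamma y
      ≤ (Gamma x ^ a * Gamma (y + α) ^ b) * (Gamma x ^ b * Gamma (y + α) ^ a) :=
        mul_le_mul h₁ h₂ (Gamma_pos_of_pos (hx.trans hxy)).le (by positivity)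
    _ = Gamma x ^ (a + b) * Gamma (y + α) ^ (a + b) := by
        rw [rpow_add gx, rpow_add gy]; ring
    _ = Gamma x * Gamma (y + α) := by rw [hab, rpow_one, rpow_one]

theorem summable_zeta {x : ℝ} (hx : 1 < x) : Summable fun n : ℕ => 1 / (n + 1 : ℝ) ^ x := by
  simpa using (summable_nat_add_iff 1).2 (Real.summable_one_div_nat_rpow.2 hx)

theorem zeta_pos {x : ℝ} (hx : 1 < x) : 0 < zeta x :=
  (summable_zeta hx).tsum_pos (fun n => by positivity) 0 (by simp)

theorem sub_mul_rpow_sub_rpow_pos {a b p : ℝ} (ha : 0 < a) (hb : 0 < b) (hp : 0 < p)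
    (hab : a ≠ b) : 0 < (a - b) * (a ^ p - b ^ p) := by
  rcases hab.lt_or_gt with h | h
  · exact mul_pos_of_neg_of_neg (sub_neg.2 h) (sub_neg.2 (Real.rpow_lt_rpow ha.le h hp))
  · exact mul_pos (sub_pos.2 h) (sub_pos.2 (Real.rpow_lt_rpow hb.le h hp))

/-- The strict log-convexity of `ζ` on `(1, ∞)` in product form. -/
theorem zeta_add_mul_zeta_lt {x y α : ℝ} (hx : 1 < x) (hxy : x < y) (hα : 0 < α) :
    zeta (x + α) * zeta y < zeta x * zeta (y + α) := by
  have hzx := zeta_pos hx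
  have hzxα : 0 < zeta (x + α) := zeta_pos (by linarith)
  set M := zeta (x + α) / zeta x with hM
  have hM0 : 0 < M := div_pos hzxα hzx
  set p := (y - x) / α with hp
  have hp0 : 0 < p := div_pos (by linarith) hα
  set f : ℕ → ℝ := fun n => 1 / (n + 1 : ℝ) ^ α with hf
  have hf0 (n : ℕ) : 0 < f n := by positivity
  have hfp (n : ℕ) : f n ^ p = 1 / (n + 1 : ℝ) ^ (y - x) := by
    have hn : (0 : ℝ) ≤ n + 1 := by positivity
    rw [hf, Real.div_rpow zero_le_one (by positivity), Real.one_rpow, ← Real.rpow_mul hn, hp,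
      mul_div_cancel₀ _ hα.ne']
  set T : ℕ → ℝ := fun n => 1 / (n + 1 : ℝ) ^ x * ((f n - M) * (f n ^ p - M ^ p)) with hT
  have hsum : HasSum T (zeta (y + α) - M ^ p * zeta (x + α) - M * zeta y
      + M * M ^ p * zeta x) := by
    have h {s : ℝ} (hs : 1 < s) : HasSum (fun n : ℕ => 1 / (n + 1 : ℝ) ^ s) (zeta s) :=
      (summable_zeta hs).hasSum
    refine ((((h (show 1 < y + α by linarith)).sub
      ((h (show 1 < x + α by linarith)).mul_left (M ^ p))).sub
      ((h (show 1 < y by linarith)).mul_left M)).add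
      ((h hx).mul_left (M * M ^ p))).congr_fun fun n => ?_
    have hn : (0 : ℝ) < n + 1 := by positivity
    simp only [hT, hfp]
    rw [hf, Real.rpow_add hn y, Real.rpow_add hn x α, Real.rpow_sub hn y x]
    field_simp
    ring
  have hpos {n : ℕ} (hn : f n ≠ M) : 0 < T n :=
    mul_pos (by positivity) (sub_mul_rpow_sub_rpow_pos (hf0 n) hM0 hp0 hn)
  have hnonneg (n : ℕ) : 0 ≤ T n := by
    by_cases hn : f n = M
    · simp [hT, hn]
    · exact (hpos hn).le
  obtain ⟨n, hn⟩ : ∃ n, f n ≠ M := by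
    by_contra! h
    have h₁ : f 1 < f 0 := by
      have : (1 : ℝ) < 2 ^ α := Real.one_lt_rpow one_lt_two hα
      simpa [hf, one_add_one_eq_two] using inv_lt_one_of_one_lt₀ this
    exact h₁.ne ((h 1).trans (h 0).symm)
  have key := hsum.summable.tsum_pos hnonneg n (hpos hn)
  rw [hsum.tsum_eq] at key
  have hMz : M * zeta x = zeta (x + α) := div_mul_cancel₀ _ hzx.ne'
  have : M * zeta y < zeta (y + α) := by
    rw [← hMz] at key
    linarith
  calc zeta (x + α) * zeta y = zeta x * (M * zeta y) := by rw [← hMz]; ring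
    _ < zeta x * zeta (y + α) := mul_lt_mul_of_pos_left this hzx

/-- For a real constant `α > 0` and an integer `ℓ ≥ 0`, the function
`x ↦ (Γ(x+α+ℓ)/(Γ(α+1)·Γ(x+ℓ))) · (ζ(x+α)/ζ(x))` is strictly increasing on `(1, ∞)`. -/
theorem zeta_ratio_strictMonoOn (α : ℝ) (hα : 0 < α) (ℓ : ℕ) :
    StrictMonoOn (fun x : ℝ =>
      (Real.Gamma (x + α + ℓ) / (Real.Gamma (α + 1) * Real.Gamma (x + ℓ))) *
        (zeta (x + α) / zeta x)) (Set.Ioi 1) := by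
  intro x hx y hy hxy
  rw [Set.mem_Ioi] at hx hy
  have hℓ : (0 : ℝ) ≤ ℓ := ℓ.cast_nonneg
  have hG {s : ℝ} (hs : 1 < s) : 0 < Real.Gamma (s + ℓ) := Real.Gamma_pos_of_pos (by linarith)
  have hGα : 0 < Real.Gamma (α + 1) := Real.Gamma_pos_of_pos (by linarith)
  have hGx := hG hx
  have hGy := hG hy
  have hGyα := hG (show 1 < y + α by linarith)
  have hgamma := Gamma_add_mul_Gamma_le (show 0 < x + ℓ by linarith)
    (show x + ℓ < y + ℓ by linarith) hα
  rw [add_right_comm x, add_right_comm y] at hgamma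
  refine mul_lt_mul' ?_ ?_ (div_pos (zeta_pos (show 1 < x + α by linarith)) (zeta_pos hx)).le
    (by positivity)
  · rw [div_le_div_iff₀ (by positivity) (by positivity)]
    linarith [mul_le_mul_of_nonneg_left hgamma hGα.le]
  · rw [div_lt_div_iff₀ (zeta_pos hx) (zeta_pos hy)]
    linarith [zeta_add_mul_zeta_lt hx hxy hα]
end

section
/- Let −∞ ≤ a < b ≤ ∞ and let U(t), V(t), and W(t,x) be functions of t ∈ (a,b) (with parameter x ranging over an interval I) such that V(t) > 0 and W(t,x) > 0 on (a,b), such that for each x the functions t ↦ W(t,x)·U(t) and t ↦ W(t,x)·V(t) are integrable on (a,b), and such that the partial derivative ∂W(t,x)/∂x exists. If the ratios t ↦ (∂W(t,x)/∂x)/W(t,x) (for each fixed x ∈ I) and t ↦ U(t)/V(t) are both increasing in t ∈ (a,b), then the ratio R(x) = (∫_a^b W(t,x)·U(t) dt)/(∫_a^b W(t,x)·V(t) dt) is increasing in x on I. -/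
open MeasureTheory

/-- If `A ⊗ B` dominates `C ⊗ D` almost everywhere after symmetrization in the two variables,
then the product of the integrals of `A` and `B` dominates that of `C` and `D`. -/
theorem integral_mul_integral_le_of_symm_le {α : Type*} [MeasurableSpace α] {μ : Measure α}
    [SFinite μ] {A B C D : α → ℝ} (hA : Integrable A μ) (hB : Integrable B μ)
    (hC : Integrable C μ) (hD : Integrable D μ)
    (h : ∀ᵐ z ∂μ.prod μ, C z.1 * D z.2 + D z.1 * C z.2 ≤ A z.1 * B z.2 + B z.1 * A z.2) :
    (∫ t, C t ∂μ) * ∫ t, D t ∂μ ≤ (∫ t, A t ∂μ) * ∫ t, B t ∂μ := by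
  have key := integral_mono_ae ((hC.mul_prod hD).add (hD.mul_prod hC))
    ((hA.mul_prod hB).add (hB.mul_prod hA)) h
  simp only [Pi.add_apply] at key
  rw [integral_add (hC.mul_prod hD) (hD.mul_prod hC),
    integral_add (hA.mul_prod hB) (hB.mul_prod hA)] at key
  simp only [integral_prod_mul] at key
  linarith

/-- If the logarithmic derivative of `f` is at most that of `g` on `[x, y]`, then `g / f`
increases from `x` to `y`; stated without division. -/
theorem mul_le_mul_of_logDeriv_le {f g f' g' : ℝ → ℝ} {x y : ℝ} (hxy : x ≤ y)
    (hf : ∀ z ∈ Set.Icc x y, HasDerivAt f (f' z) z)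
    (hg : ∀ z ∈ Set.Icc x y, HasDerivAt g (g' z) z)
    (hf0 : ∀ z ∈ Set.Icc x y, 0 < f z) (hg0 : ∀ z ∈ Set.Icc x y, 0 < g z)
    (hle : ∀ z ∈ Set.Icc x y, f' z / f z ≤ g' z / g z) :
    g x * f y ≤ g y * f x := by
  have hd : ∀ z ∈ Set.Icc x y,
      HasDerivAt (fun z => g z / f z) ((g' z * f z - g z * f' z) / f z ^ 2) z :=
    fun z hz => (hg z hz).div (hf z hz) (hf0 z hz).ne'
  have hmono : MonotoneOn (fun z => g z / f z) (Set.Icc x y) := by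
    refine monotoneOn_of_hasDerivWithinAt_nonneg (convex_Icc x y)
      (fun z hz => (hd z hz).continuousAt.continuousWithinAt)
      (fun z hz => (hd z (interior_subset hz)).hasDerivWithinAt) fun z hz => ?_
    have hz := interior_subset hz
    have h := hle z hz
    rw [div_le_div_iff₀ (hf0 z hz) (hg0 z hz)] at h
    exact div_nonneg (by linarith) (sq_nonneg _)
  have hx := Set.left_mem_Icc.2 hxy
  have hy := Set.right_mem_Icc.2 hxy
  exact (div_le_div_iff₀ (hf0 x hx) (hf0 y hy)).1 (hmono hx hy hxy)

/-- Monotonicity rule for the ratio of two integrals with a parameter: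
with `−∞ ≤ a < b ≤ ∞`, if `V > 0` and `W > 0` on `(a,b)`, the functions
`t ↦ W(t,x)U(t)` and `t ↦ W(t,x)V(t)` are integrable on `(a,b)` for each `x` in an
interval `I`, the partial derivative `∂W(t,x)/∂x` exists, and both
`t ↦ (∂W(t,x)/∂x)/W(t,x)` (for each fixed `x ∈ I`) and `t ↦ U(t)/V(t)` are increasing
on `(a,b)`, then `R(x) = (∫_a^b W(t,x)U(t) dt)/(∫_a^b W(t,x)V(t) dt)` is increasing
in `x` on `I`. -/
theorem monotone_integral_ratio (a b : EReal) (hab : a < b)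
    (U V : ℝ → ℝ) (W W' : ℝ → ℝ → ℝ) (I : Set ℝ) (hI : I.OrdConnected)
    (hV : ∀ t : ℝ, a < (t : EReal) → (t : EReal) < b → 0 < V t)
    (hW : ∀ x ∈ I, ∀ t : ℝ, a < (t : EReal) → (t : EReal) < b → 0 < W t x)
    (hUint : ∀ x ∈ I,
      IntegrableOn (fun t => W t x * U t) {t : ℝ | a < (t : EReal) ∧ (t : EReal) < b})
    (hVint : ∀ x ∈ I,
      IntegrableOn (fun t => W t x * V t) {t : ℝ | a < (t : EReal) ∧ (t : EReal) < b})
    (hW' : ∀ x ∈ I, ∀ t : ℝ, a < (t : EReal) → (t : EReal) < b →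
      HasDerivAt (fun y => W t y) (W' t x) x)
    (hWmono : ∀ x ∈ I,
      MonotoneOn (fun t => W' t x / W t x) {t : ℝ | a < (t : EReal) ∧ (t : EReal) < b})
    (hUVmono : MonotoneOn (fun t => U t / V t) {t : ℝ | a < (t : EReal) ∧ (t : EReal) < b}) :
    MonotoneOn (fun x =>
      (∫ t in {t : ℝ | a < (t : EReal) ∧ (t : EReal) < b}, W t x * U t) /
        (∫ t in {t : ℝ | a < (t : EReal) ∧ (t : EReal) < b}, W t x * V t)) I := by
  set S : Set ℝ := {t : ℝ | a < (t : EReal) ∧ (t : EReal) < b}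
  have hSopen : IsOpen S := isOpen_Ioo.preimage continuous_coe_real_ereal
  have hSne : S.Nonempty := EReal.lt_iff_exists_real_btwn.1 hab
  have hpos : ∀ x ∈ I, 0 < ∫ t in S, W t x * V t := fun x hx => by
    have h0 : ∀ t ∈ S, 0 < W t x * V t := fun t ht => mul_pos (hW x hx t ht.1 ht.2) (hV t ht.1 ht.2)
    rw [setIntegral_pos_iff_support_of_nonneg_ae
      (ae_restrict_of_forall_mem hSopen.measurableSet fun t ht => (h0 t ht).le) (hVint x hx),
      Set.inter_eq_right.2 fun t ht => Function.mem_support.2 (h0 t ht).ne']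
    exact hSopen.measure_pos volume hSne
  intro x hx y hy hxy
  have hWle : ∀ s ∈ S, ∀ t ∈ S, s ≤ t → W t x * W s y ≤ W t y * W s x := fun s hs t ht hst =>
    mul_le_mul_of_logDeriv_le hxy
      (fun z hz => hW' z (hI.out hx hy hz) s hs.1 hs.2)
      (fun z hz => hW' z (hI.out hx hy hz) t ht.1 ht.2)
      (fun z hz => hW z (hI.out hx hy hz) s hs.1 hs.2)
      (fun z hz => hW z (hI.out hx hy hz) t ht.1 ht.2)
      (fun z hz => hWmono z (hI.out hx hy hz) hs ht hst)
  have hUle : ∀ s ∈ S, ∀ t ∈ S, s ≤ t → U s * V t ≤ U t * V s := fun s hs t ht hst =>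
    (div_le_div_iff₀ (hV s hs.1 hs.2) (hV t ht.1 ht.2)).1 (hUVmono hs ht hst)
  refine (div_le_div_iff₀ (hpos x hx) (hpos y hy)).2 ?_
  refine integral_mul_integral_le_of_symm_le (hUint y hy) (hVint x hx) (hUint x hx) (hVint y hy) ?_
  rw [Measure.prod_restrict]
  refine ae_restrict_of_forall_mem (hSopen.measurableSet.prod hSopen.measurableSet) ?_
  rintro ⟨s, t⟩ ⟨hs, ht⟩
  rcases le_total s t with hst | hst
  · nlinarith [mul_nonneg (sub_nonneg.2 (hWle s hs t ht hst)) (sub_nonneg.2 (hUle s hs t ht hst))]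
  · nlinarith [mul_nonneg (sub_nonneg.2 (hWle t ht s hs hst)) (sub_nonneg.2 (hUle t ht s hs hst))]
end

section
/- Let −∞ ≤ a < b ≤ ∞ and let U(t), V(t), and W(t,x) be functions of t ∈ (a,b) (with parameter x ranging over an interval I) such that V(t) > 0 and W(t,x) > 0 on (a,b), such that for each x the functions t ↦ W(t,x)·U(t) and t ↦ W(t,x)·V(t) are integrable on (a,b), and such that the partial derivative ∂W(t,x)/∂x exists. If the ratio t ↦ (∂W(t,x)/∂x)/W(t,x) (for each fixed x ∈ I) is increasing in t ∈ (a,b) and the ratio t ↦ U(t)/V(t) is decreasing in t ∈ (a,b) (or vice versa: the first decreasing and the second increasing), then the ratio R(x) = (∫_a^b W(t,x)·U(t) dt)/(∫_a^b W(t,x)·V(t) dt) is decreasing in x on I. -/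
open MeasureTheory

/-- If the logarithmic derivative of `p` is at most that of `q` on `[x, y]`, then `q / p` does not
decrease from `x` to `y`. -/
theorem mul_le_mul_of_logDeriv_le_s5 {p q p' q' : ℝ → ℝ} {x y : ℝ} (hxy : x ≤ y)
    (hp : ∀ z ∈ Set.Icc x y, 0 < p z) (hq : ∀ z ∈ Set.Icc x y, 0 < q z)
    (hp' : ∀ z ∈ Set.Icc x y, HasDerivAt p (p' z) z)
    (hq' : ∀ z ∈ Set.Icc x y, HasDerivAt q (q' z) z)
    (hle : ∀ z ∈ Set.Icc x y, p' z / p z ≤ q' z / q z) :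
    p y * q x ≤ q y * p x := by
  have hd : ∀ z ∈ Set.Icc x y,
      HasDerivAt (fun z => q z / p z) ((q' z * p z - q z * p' z) / p z ^ 2) z := fun z hz =>
    (hq' z hz).fun_div (hp' z hz) (hp z hz).ne'
  have hmono : MonotoneOn (fun z => q z / p z) (Set.Icc x y) := by
    refine monotoneOn_of_hasDerivWithinAt_nonneg (convex_Icc x y)
      (fun z hz => (hd z hz).continuousAt.continuousWithinAt)
      (fun z hz => (hd z (interior_subset hz)).hasDerivWithinAt) fun z hz => ?_
    have hz := interior_subset hz
    have h := (div_le_div_iff₀ (hp z hz) (hq z hz)).1 (hle z hz)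
    exact div_nonneg (by linarith) (sq_nonneg _)
  have hx := Set.left_mem_Icc.2 hxy
  have hy := Set.right_mem_Icc.2 hxy
  have h := (div_le_div_iff₀ (hp x hx) (hp y hy)).1 (hmono hx hy hxy)
  linarith

/-- A Chebyshev-type integral inequality: if `g / f` and `U / V` are oppositely ordered on `S`, then
`(∫ g U) (∫ f V) ≤ (∫ f U) (∫ g V)`. -/
theorem setIntegral_mul_setIntegral_le {α : Type*} [MeasurableSpace α] {μ : Measure α}
    {S : Set α} (hS : MeasurableSet S) {f g U V : α → ℝ}
    (hfU : IntegrableOn (fun t => f t * U t) S μ) (hfV : IntegrableOn (fun t => f t * V t) S μ)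
    (hgU : IntegrableOn (fun t => g t * U t) S μ) (hgV : IntegrableOn (fun t => g t * V t) S μ)
    (h : ∀ s ∈ S, ∀ t ∈ S, (g t * f s - f t * g s) * (U t * V s - U s * V t) ≤ 0) :
    (∫ t in S, g t * U t ∂μ) * (∫ t in S, f t * V t ∂μ) ≤
      (∫ t in S, f t * U t ∂μ) * (∫ t in S, g t * V t ∂μ) := by
  set A := ∫ t in S, g t * U t ∂μ
  set B := ∫ t in S, f t * V t ∂μ
  set C := ∫ t in S, f t * U t ∂μ
  set D := ∫ t in S, g t * V t ∂μ
  have hinner : ∀ s ∈ S,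
      A * (f s * V s) + B * (g s * U s) - (C * (g s * V s) + D * (f s * U s)) ≤ 0 := by
    intro s hs
    have key := setIntegral_nonpos (μ := μ) hS (h s hs)
    have e : ∀ t, (g t * f s - f t * g s) * (U t * V s - U s * V t) =
        g t * U t * (f s * V s) + f t * V t * (g s * U s) -
          (f t * U t * (g s * V s) + g t * V t * (f s * U s)) := fun t => by ring
    simp_rw [e] at key
    rwa [integral_sub ((hgU.mul_const _).fun_add (hfV.mul_const _))
        ((hfU.mul_const _).fun_add (hgV.mul_const _)),
      integral_add (hgU.mul_const _) (hfV.mul_const _),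
      integral_add (hfU.mul_const _) (hgV.mul_const _), integral_mul_const, integral_mul_const,
      integral_mul_const, integral_mul_const] at key
  have key := setIntegral_nonpos (μ := μ) hS hinner
  rw [integral_sub ((hfV.const_mul _).fun_add (hgU.const_mul _))
      ((hgV.const_mul _).fun_add (hfU.const_mul _)),
    integral_add (hfV.const_mul _) (hgU.const_mul _),
    integral_add (hgV.const_mul _) (hfU.const_mul _), integral_const_mul, integral_const_mul,
    integral_const_mul, integral_const_mul] at key
  linarith

/-- Monotonicity rule for the ratio of two integrals with a parameter:
with `−∞ ≤ a < b ≤ ∞`, if `V > 0` and `W > 0` on `(a,b)`, the functions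
`t ↦ W(t,x)U(t)` and `t ↦ W(t,x)V(t)` are integrable on `(a,b)` for each `x` in an
interval `I`, the partial derivative `∂W(t,x)/∂x` exists, and one of the ratios
`t ↦ (∂W(t,x)/∂x)/W(t,x)` (for each fixed `x ∈ I`) and `t ↦ U(t)/V(t)` is increasing
while the other is decreasing on `(a,b)`, then
`R(x) = (∫_a^b W(t,x)U(t) dt)/(∫_a^b W(t,x)V(t) dt)` is decreasing in `x` on `I`. -/
theorem antitone_integral_ratio (a b : EReal) (hab : a < b)
    (U V : ℝ → ℝ) (W W' : ℝ → ℝ → ℝ) (I : Set ℝ) (hI : I.OrdConnected)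
    (hV : ∀ t : ℝ, a < (t : EReal) → (t : EReal) < b → 0 < V t)
    (hW : ∀ x ∈ I, ∀ t : ℝ, a < (t : EReal) → (t : EReal) < b → 0 < W t x)
    (hUint : ∀ x ∈ I,
      IntegrableOn (fun t => W t x * U t) {t : ℝ | a < (t : EReal) ∧ (t : EReal) < b})
    (hVint : ∀ x ∈ I,
      IntegrableOn (fun t => W t x * V t) {t : ℝ | a < (t : EReal) ∧ (t : EReal) < b})
    (hW' : ∀ x ∈ I, ∀ t : ℝ, a < (t : EReal) → (t : EReal) < b →
      HasDerivAt (fun y => W t y) (W' t x) x)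
    (hopp :
      ((∀ x ∈ I, MonotoneOn (fun t => W' t x / W t x)
            {t : ℝ | a < (t : EReal) ∧ (t : EReal) < b}) ∧
          AntitoneOn (fun t => U t / V t) {t : ℝ | a < (t : EReal) ∧ (t : EReal) < b}) ∨
        ((∀ x ∈ I, AntitoneOn (fun t => W' t x / W t x)
            {t : ℝ | a < (t : EReal) ∧ (t : EReal) < b}) ∧
          MonotoneOn (fun t => U t / V t) {t : ℝ | a < (t : EReal) ∧ (t : EReal) < b})) :
    AntitoneOn (fun x =>
      (∫ t in {t : ℝ | a < (t : EReal) ∧ (t : EReal) < b}, W t x * U t) /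
        (∫ t in {t : ℝ | a < (t : EReal) ∧ (t : EReal) < b}, W t x * V t)) I := by
  set S := {t : ℝ | a < (t : EReal) ∧ (t : EReal) < b}
  have hSo : IsOpen S :=
    (isOpen_lt continuous_const continuous_coe_real_ereal).inter
      (isOpen_lt continuous_coe_real_ereal continuous_const)
  have hSm : MeasurableSet S := hSo.measurableSet
  have hSne : S.Nonempty := EReal.lt_iff_exists_real_btwn.1 hab
  have hpos : ∀ x ∈ I, 0 < ∫ t in S, W t x * V t := by
    intro x hx
    have hWV : ∀ t ∈ S, 0 < W t x * V t := fun t ht =>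
      mul_pos (hW x hx t ht.1 ht.2) (hV t ht.1 ht.2)
    rw [setIntegral_pos_iff_support_of_nonneg_ae
      (ae_restrict_of_forall_mem hSm fun t ht => (hWV t ht).le) (hVint x hx),
      Set.inter_eq_right.2 fun t ht => Function.mem_support.2 (hWV t ht).ne']
    exact hSo.measure_pos volume hSne
  intro x hx y hy hxy
  have hsub : Set.Icc x y ⊆ I := hI.out hx hy
  have hratio : ∀ s ∈ S, ∀ t ∈ S, (∀ z ∈ I, W' s z / W s z ≤ W' t z / W t z) →
      W s y * W t x ≤ W t y * W s x := fun s hs t ht h =>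
    mul_le_mul_of_logDeriv_le_s5 hxy (fun z hz => hW z (hsub hz) s hs.1 hs.2)
      (fun z hz => hW z (hsub hz) t ht.1 ht.2) (fun z hz => hW' z (hsub hz) s hs.1 hs.2)
      (fun z hz => hW' z (hsub hz) t ht.1 ht.2) fun z hz => h z (hsub hz)
  have hUV : ∀ s ∈ S, ∀ t ∈ S, U s / V s ≤ U t / V t → U s * V t ≤ U t * V s :=
    fun s hs t ht h => (div_le_div_iff₀ (hV s hs.1 hs.2) (hV t ht.1 ht.2)).1 h
  refine (div_le_div_iff₀ (hpos y hy) (hpos x hx)).2 <|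
    setIntegral_mul_setIntegral_le hSm (hUint x hx) (hVint x hx) (hUint y hy) (hVint y hy)
      fun s hs t ht => ?_
  rcases hopp with ⟨hm, ha⟩ | ⟨ha, hm⟩ <;> rcases le_total s t with hst | hst
  · have h₁ := hratio s hs t ht fun z hz => hm z hz hs ht hst
    have h₂ := hUV t ht s hs (ha hs ht hst)
    exact mul_nonpos_of_nonneg_of_nonpos (by linarith) (by linarith)
  · have h₁ := hratio t ht s hs fun z hz => hm z hz ht hs hst
    have h₂ := hUV s hs t ht (ha ht hs hst)
    exact mul_nonpos_of_nonpos_of_nonneg (by linarith) (by linarith)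
  · have h₁ := hratio t ht s hs fun z hz => ha z hz hs ht hst
    have h₂ := hUV s hs t ht (hm hs ht hst)
    exact mul_nonpos_of_nonpos_of_nonneg (by linarith) (by linarith)
  · have h₁ := hratio s hs t ht fun z hz => ha z hz ht hs hst
    have h₂ := hUV t ht s hs (hm ht hs hst)
    exact mul_nonpos_of_nonneg_of_nonpos (by linarith) (by linarith)
end

section
/- For every integer k ≥ 0 and every real t > 0, the function F_k(t) = (−1)^k · (d/dt)^k [1/(e^t − 1)] satisfies F_k(t) > 0. -/
/-- `F_k(t) = (−1)^k · (d/dt)^k [1/(e^t − 1)]`. -/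
noncomputable def F (k : ℕ) (t : ℝ) : ℝ :=
  (-1) ^ k * iteratedDeriv k (fun s => 1 / (Real.exp s - 1)) t

open Polynomial in
/-- A polynomial with natural coefficients and nonzero linear term is positive at positive reals. -/
theorem aeval_pos_of_coeff_one_ne_zero (p : ℕ[X]) (hp : p.coeff 1 ≠ 0) {u : ℝ} (hu : 0 < u) :
    0 < aeval u p := by
  rw [aeval_eq_sum_range, Finset.sum_congr rfl fun i _ => nsmul_eq_mul (p.coeff i) (u ^ i)]
  refine Finset.sum_pos' (fun i _ => by positivity) ⟨1, ?_, ?_⟩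
  · exact Finset.mem_range_succ_iff.2 (le_natDegree_of_ne_zero hp)
  · have : (0 : ℝ) < p.coeff 1 := by exact_mod_cast Nat.pos_of_ne_zero hp
    positivity

/-- The function `u = 1 / (e^t - 1)` satisfies `u' = -(u + u ^ 2)`. -/
theorem hasDerivAt_one_div_exp_sub_one {t : ℝ} (ht : 0 < t) :
    HasDerivAt (fun s => 1 / (Real.exp s - 1))
      (-(1 / (Real.exp t - 1) + (1 / (Real.exp t - 1)) ^ 2)) t := by
  have h : Real.exp t - 1 ≠ 0 := (sub_pos.2 (Real.one_lt_exp_iff.2 ht)).ne'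
  have hd := ((Real.hasDerivAt_exp t).sub_const 1).inv h
  simp only [one_div]
  refine hd.congr_deriv ?_
  field_simp
  ring

open Polynomial in
/-- Up to sign, each derivative of `u = 1 / (e^t - 1)` is a polynomial in `u` with natural
coefficients and linear coefficient `1`. -/
theorem exists_iteratedDeriv_one_div_exp_sub_one (k : ℕ) :
    ∃ p : ℕ[X], p.coeff 1 = 1 ∧ ∀ t : ℝ, 0 < t →
      iteratedDeriv k (fun s => 1 / (Real.exp s - 1)) t =
        (-1) ^ k * aeval (1 / (Real.exp t - 1)) p := by
  induction k with
  | zero => exact ⟨X, by simp, fun t _ => by simp⟩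
  | succ k ih =>
    obtain ⟨p, hp, h⟩ := ih
    refine ⟨derivative p * (1 + X) * X, ?_, fun t ht => ?_⟩
    · rw [coeff_mul_X _ 0, mul_coeff_zero, coeff_derivative]
      simp [hp]
    · have he : iteratedDeriv k (fun s => 1 / (Real.exp s - 1)) =ᶠ[nhds t]
          fun s => (-1) ^ k * aeval (1 / (Real.exp s - 1)) p :=
        (eventually_gt_nhds ht).mono h
      have hd := (((p.hasDerivAt_aeval (1 / (Real.exp t - 1))).comp t
        (hasDerivAt_one_div_exp_sub_one ht)).const_mul ((-1) ^ k))
      rw [iteratedDeriv_succ, he.deriv_eq]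
      refine hd.deriv.trans ?_
      simp only [map_mul, map_add, map_one, aeval_X]
      ring

/-- For every integer `k ≥ 0` and every real `t > 0`, `F_k(t) > 0`. -/
theorem F_pos (k : ℕ) (t : ℝ) (ht : 0 < t) : 0 < F k t := by
  obtain ⟨p, hp, h⟩ := exists_iteratedDeriv_one_div_exp_sub_one k
  rw [F, h t ht, ← mul_assoc, ← mul_pow]
  simpa using aeval_pos_of_coeff_one_ne_zero p (by simp [hp])
    (one_div_pos.2 (sub_pos.2 (Real.one_lt_exp_iff.2 ht)))
end

section
/- For every real x > 1, the integral ∫_0^∞ (e^t · t^x)/(e^t − 1)^2 dt equals Γ(x+1)·ζ(x), where Γ is the Euler gamma function and ζ is the Riemann zeta function. -/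
open MeasureTheory in
theorem integrableOn_rpow_mul_exp_neg_mul {x r : ℝ} (hx : -1 < x) (hr : 0 < r) :
    IntegrableOn (fun t : ℝ ↦ t ^ x * Real.exp (-(r * t))) (Set.Ioi 0) := by
  simpa using integrableOn_rpow_mul_exp_neg_mul_rpow hx one_pos hr

theorem integral_rpow_mul_mul_exp_neg_mul {x r : ℝ} (hx : -1 < x) (hr : 0 < r) :
    ∫ t in Set.Ioi (0 : ℝ), r * (t ^ x * Real.exp (-(r * t))) =
      Real.Gamma (x + 1) * (1 / r ^ x) := by
  have h := Real.integral_rpow_mul_exp_neg_mul_Ioi (a := x + 1) (by linarith) hr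
  rw [add_sub_cancel_right] at h
  rw [MeasureTheory.integral_const_mul, h, Real.div_rpow zero_le_one hr.le, Real.one_rpow,
    Real.rpow_add_one hr.ne']
  field_simp

theorem hasSum_succ_mul_exp_neg_mul {t : ℝ} (ht : 0 < t) :
    HasSum (fun n : ℕ ↦ (n + 1 : ℝ) * Real.exp (-((n + 1 : ℝ) * t)))
      (Real.exp t / (Real.exp t - 1) ^ 2) := by
  have hlt : ‖Real.exp (-t)‖ < 1 := by simpa using ht
  have h := hasSum_coe_mul_geometric_of_norm_lt_one hlt
  rw [← hasSum_nat_add_iff' 1] at h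
  have h1 : Real.exp t - 1 ≠ 0 := (sub_pos.2 (Real.one_lt_exp_iff.2 ht)).ne'
  convert! h using 1
  · ext n
    rw [← Real.exp_nat_mul]
    push_cast
    ring_nf
  · have h2 : 1 - (Real.exp t)⁻¹ = (Real.exp t - 1) / Real.exp t := by
      field_simp
    simp only [Finset.range_one, Finset.sum_singleton, Nat.cast_zero, zero_mul, sub_zero,
      Real.exp_neg, h2]
    field_simp

/-- For every real `x > 1`, `∫_0^∞ (e^t · t^x)/(e^t − 1)^2 dt = Γ(x+1)·ζ(x)`. -/
theorem integral_exp_rpow_div_sq (x : ℝ) (hx : 1 < x) :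
    ∫ t in Set.Ioi (0 : ℝ), Real.exp t * t ^ x / (Real.exp t - 1) ^ 2 =
      Real.Gamma (x + 1) * zeta x := by
  have hx' : -1 < x := by linarith
  have hpos (n : ℕ) : (0 : ℝ) < n + 1 := n.cast_add_one_pos
  let F (n : ℕ) (t : ℝ) : ℝ := (n + 1 : ℝ) * (t ^ x * Real.exp (-((n + 1 : ℝ) * t)))
  have hF (n : ℕ) : ∫ t in Set.Ioi (0 : ℝ), F n t =
      Real.Gamma (x + 1) * (1 / (n + 1 : ℝ) ^ x) :=
    integral_rpow_mul_mul_exp_neg_mul hx' (hpos n)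
  have hnorm (n : ℕ) : ∫ t in Set.Ioi (0 : ℝ), ‖F n t‖ =
      Real.Gamma (x + 1) * (1 / (n + 1 : ℝ) ^ x) := by
    rw [← hF n]
    refine MeasureTheory.setIntegral_congr_fun measurableSet_Ioi fun t ht ↦ ?_
    have ht' : (0 : ℝ) < t := ht
    exact Real.norm_of_nonneg (by positivity)
  have hsum : Summable fun n : ℕ ↦ 1 / (n + 1 : ℝ) ^ x := by
    simpa using (summable_nat_add_iff 1).2 (Real.summable_one_div_nat_rpow.2 hx)
  have key := MeasureTheory.hasSum_integral_of_summable_integral_norm (F := F)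
    (μ := MeasureTheory.volume.restrict (Set.Ioi 0))
    (fun n ↦ (integrableOn_rpow_mul_exp_neg_mul hx' (hpos n)).const_mul _)
    (by simpa only [hnorm] using hsum.mul_left _)
  simp only [hF] at key
  rw [zeta, ← tsum_mul_left, key.tsum_eq]
  refine MeasureTheory.setIntegral_congr_fun measurableSet_Ioi fun t ht ↦ ?_
  have h := ((hasSum_succ_mul_exp_neg_mul ht).mul_left (t ^ x)).tsum_eq
  simp only [F, mul_left_comm _ (t ^ x), h]
  ring
end

section
/- For every integer k ≥ 1 and every real x > 1, the integral ∫_0^∞ F_k(t) · t^{x+k−1} dt equals Γ(x+k)·ζ(x), where F_k(t) = (−1)^k · (d/dt)^k [1/(e^t − 1)], Γ is the Euler gamma function, and ζ is the Riemann zeta function. -/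
open Real Set Topology in
/-- Away from `0`, the `k`-th derivative of `1 / (e^t - 1)` is obtained by differentiating
the geometric series `∑ e^{-(n+1)t}` termwise. -/
lemma hasSum_iteratedDeriv_one_div_exp_sub_one (k : ℕ) {t : ℝ} (ht : 0 < t) :
    HasSum (fun n : ℕ => (-((n : ℝ) + 1)) ^ k * exp (-(((n : ℝ) + 1) * t)))
      (iteratedDeriv k (fun s => 1 / (exp s - 1)) t) := by
  have summable_bound (j : ℕ) {a : ℝ} (ha : 0 < a) :
      Summable fun n : ℕ => ((n : ℝ) + 1) ^ j * exp (-(((n : ℝ) + 1) * a)) := by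
    have h := (summable_nat_add_iff 1).2 (summable_pow_mul_exp_neg_nat_mul j ha)
    refine h.congr fun n => ?_
    push_cast
    congr 2
    ring
  have summable_terms (j : ℕ) {a : ℝ} (ha : 0 < a) :
      Summable fun n : ℕ => (-((n : ℝ) + 1)) ^ j * exp (-(((n : ℝ) + 1) * a)) := by
    refine Summable.of_norm ((summable_bound j ha).congr fun n => ?_)
    rw [norm_mul, norm_pow, norm_neg, norm_of_nonneg (by positivity : (0 : ℝ) ≤ n + 1),
      norm_of_nonneg (exp_pos _).le]
  induction k generalizing t with
  | zero =>
    have h := (hasSum_geometric_of_lt_one (exp_pos (-t)).le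
      (exp_lt_one_iff.2 (neg_lt_zero.2 ht))).mul_left (exp (-t))
    convert! h using 1
    · funext n
      rw [pow_zero, one_mul, ← exp_nat_mul, ← exp_add]
      congr 1
      ring
    · rw [iteratedDeriv_zero, exp_neg]
      field_simp
  | succ k ih =>
    have hderiv := hasDerivAt_tsum_of_isPreconnected
      (g := fun (n : ℕ) (s : ℝ) => (-((n : ℝ) + 1)) ^ k * exp (-(((n : ℝ) + 1) * s)))
      (g' := fun (n : ℕ) (s : ℝ) => (-((n : ℝ) + 1)) ^ (k + 1) * exp (-(((n : ℝ) + 1) * s)))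
      (summable_bound (k + 1) (half_pos ht)) isOpen_Ioi isPreconnected_Ioi
      (fun n s _ => by
        have h : HasDerivAt (fun s => (-((n : ℝ) + 1)) ^ k * exp (-(((n : ℝ) + 1) * s))) _ s :=
          ((hasDerivAt_id s).const_mul ((n : ℝ) + 1)).neg.exp.const_mul _
        convert! h using 1
        simp only [Pi.neg_apply, id, pow_succ]
        ring)
      (fun n s hs => by
        rw [norm_mul, norm_pow, norm_neg, norm_of_nonneg (by positivity : (0 : ℝ) ≤ n + 1),
          norm_of_nonneg (exp_pos _).le]
        have : t / 2 ≤ s := le_of_lt hs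
        gcongr)
      (half_lt_self ht) (summable_terms k ht) (half_lt_self ht)
    have heq : iteratedDeriv k (fun s => 1 / (exp s - 1)) =ᶠ[𝓝 t]
        fun s => ∑' n : ℕ, (-((n : ℝ) + 1)) ^ k * exp (-(((n : ℝ) + 1) * s)) := by
      filter_upwards [Ioi_mem_nhds ht] with s hs using (ih hs).tsum_eq.symm
    rw [iteratedDeriv_succ, heq.deriv_eq, hderiv.deriv]
    exact (summable_terms (k + 1) ht).hasSum

/-- The function `F k` is a Dirichlet-type series of exponentials on `(0, ∞)`. -/
lemma hasSum_F (k : ℕ) {t : ℝ} (ht : 0 < t) :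
    HasSum (fun n : ℕ => ((n : ℝ) + 1) ^ k * Real.exp (-(((n : ℝ) + 1) * t))) (F k t) := by
  refine ((hasSum_iteratedDeriv_one_div_exp_sub_one k ht).mul_left ((-1) ^ k)).congr_fun
    fun n => ?_
  rw [← mul_assoc, ← mul_pow, neg_one_mul, neg_neg]

/-- For every integer `k ≥ 1` and real `x > 1`,
`∫_0^∞ F_k(t) · t^{x+k−1} dt = Γ(x+k)·ζ(x)`. -/
theorem integral_F_rpow (k : ℕ) (hk : 1 ≤ k) (x : ℝ) (hx : 1 < x) :
    ∫ t in Set.Ioi (0 : ℝ), F k t * t ^ (x + k - 1) =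
      Real.Gamma (x + k) * zeta x := by
  have ha : 0 < x + k := by positivity
  have hterm (n : ℕ) : ∫ t in Set.Ioi (0 : ℝ),
      ((n : ℝ) + 1) ^ k * (t ^ (x + k - 1) * Real.exp (-(((n : ℝ) + 1) * t))) =
        Real.Gamma (x + k) * (1 / ((n : ℝ) + 1) ^ x) := by
    have hn : (0 : ℝ) < n + 1 := by positivity
    rw [MeasureTheory.integral_const_mul, Real.integral_rpow_mul_exp_neg_mul_Ioi ha hn,
      Real.div_rpow zero_le_one hn.le, Real.one_rpow, Real.rpow_add hn, Real.rpow_natCast]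
    field_simp
  have hsummable : Summable fun n : ℕ => Real.Gamma (x + k) * (1 / ((n : ℝ) + 1) ^ x) := by
    have h := (summable_nat_add_iff 1).2 (Real.summable_one_div_nat_rpow.2 hx)
    push_cast at h
    exact h.mul_left _
  have hsum := MeasureTheory.hasSum_integral_of_summable_integral_norm
    (μ := MeasureTheory.volume.restrict (Set.Ioi (0 : ℝ)))
    (F := fun (n : ℕ) (t : ℝ) =>
      ((n : ℝ) + 1) ^ k * (t ^ (x + k - 1) * Real.exp (-(((n : ℝ) + 1) * t))))
    (fun n => by
      refine not_imp_comm.1 MeasureTheory.integral_undef ?_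
      rw [hterm n]
      have := Real.Gamma_pos_of_pos ha
      positivity)
    (hsummable.congr fun n => by
      rw [← hterm n]
      refine MeasureTheory.setIntegral_congr_fun measurableSet_Ioi fun t ht => ?_
      have ht : 0 < t := ht
      exact (Real.norm_of_nonneg (by positivity)).symm)
  simp only [hterm] at hsum
  rw [zeta, ← tsum_mul_left, hsum.tsum_eq]
  refine MeasureTheory.setIntegral_congr_fun measurableSet_Ioi fun t ht => ?_
  refine (((hasSum_F k ht).mul_right (t ^ (x + k - 1))).congr_fun fun n => ?_).tsum_eq.symm
  ring
end

section
/- Let α > 0 be a real constant, ℓ ≥ 1 an integer, and 1 < x < y real numbers. Then Γ(x+α+ℓ)·ζ(x+α)·Γ(y+ℓ)·ζ(y) < Γ(y+α+ℓ)·ζ(y+α)·Γ(x+ℓ)·ζ(x). -/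
/-- Hölder's inequality for the zeta function, i.e. its logarithmic convexity. -/
theorem zeta_mul_add_mul_le_rpow_mul_rpow {s t a b : ℝ} (hs : 1 < s) (ht : 1 < t)
    (ha : 0 < a) (hb : 0 < b) (hab : a + b = 1) :
    zeta (a * s + b * t) ≤ zeta s ^ a * zeta t ^ b := by
  have hpow (r c : ℝ) (hc : 0 < c) (n : ℕ) :
      ((1 / (n + 1 : ℝ) ^ r) ^ c) ^ (1 / c) = 1 / (n + 1 : ℝ) ^ r := by
    rw [← Real.rpow_mul (by positivity), mul_one_div_cancel hc.ne', Real.rpow_one]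
  have h := Real.inner_le_Lp_mul_Lq_tsum_of_nonneg (p := 1 / a) (q := 1 / b)
    (f := fun n : ℕ => (1 / (n + 1 : ℝ) ^ s) ^ a) (g := fun n : ℕ => (1 / (n + 1 : ℝ) ^ t) ^ b)
    (Real.holderConjugate_one_div ha hb hab) (fun n => by positivity) (fun n => by positivity)
    (by simpa only [hpow s a ha] using summable_zeta hs)
    (by simpa only [hpow t b hb] using summable_zeta ht)
  simp only [hpow s a ha, hpow t b hb, one_div_one_div] at h
  refine le_of_eq_of_le (tsum_congr fun n => ?_) h
  have hn : (0 : ℝ) < n + 1 := by positivity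
  simp only [one_div, ← Real.rpow_neg hn.le, ← Real.rpow_mul hn.le, ← Real.rpow_add hn]
  ring_nf

/-- A positive function that is multiplicatively convex on a ray satisfies the cross-multiplied
inequality for shifted arguments. -/
theorem mul_le_mul_of_rpow_convex {f : ℝ → ℝ} {c : ℝ} (hpos : ∀ s, c < s → 0 < f s)
    (hf : ∀ s t a b : ℝ, c < s → c < t → 0 < a → 0 < b → a + b = 1 →
      f (a * s + b * t) ≤ f s ^ a * f t ^ b)
    {x y α : ℝ} (hα : 0 < α) (hx : c < x) (hxy : x < y) :
    f (x + α) * f y ≤ f (y + α) * f x := by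
  have hy : c < y + α := by linarith
  have hd : 0 < y + α - x := by linarith
  have hfx := hpos x hx
  have hfy := hpos (y + α) hy
  set a := (y - x) / (y + α - x) with ha_def
  set b := α / (y + α - x) with hb_def
  have ha : 0 < a := div_pos (by linarith) hd
  have hb : 0 < b := div_pos hα hd
  have hab : a + b = 1 := by rw [ha_def, hb_def]; field_simp; ring
  have hbd : b * (y + α - x) = α := div_mul_cancel₀ _ hd.ne'
  have h₁ := hf x (y + α) a b hx hy ha hb hab
  have h₂ := hf x (y + α) b a hx hy hb ha (by linarith)
  rw [show a * x + b * (y + α) = x + α by rw [show a = 1 - b by linarith]; linarith] at h₁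
  rw [show b * x + a * (y + α) = y by rw [show a = 1 - b by linarith]; linarith] at h₂
  calc f (x + α) * f y
      ≤ (f x ^ a * f (y + α) ^ b) * (f x ^ b * f (y + α) ^ a) :=
        mul_le_mul h₁ h₂ (hpos y (by linarith)).le (by positivity)
    _ = (f (y + α) ^ a * f (y + α) ^ b) * (f x ^ a * f x ^ b) := by ring
    _ = f (y + α) * f x := by
        rw [← Real.rpow_add hfx, ← Real.rpow_add hfy, hab, Real.rpow_one, Real.rpow_one]

theorem zeta_add_mul_zeta_le {x y α : ℝ} (hα : 0 < α) (hx : 1 < x) (hxy : x < y) :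
    zeta (x + α) * zeta y ≤ zeta (y + α) * zeta x :=
  mul_le_mul_of_rpow_convex (fun _ => zeta_pos)
    (fun _ _ _ _ => zeta_mul_add_mul_le_rpow_mul_rpow) hα hx hxy

theorem Gamma_add_mul_Gamma_lt {x y α : ℝ} (hα : 0 < α) (hx : 0 < x) (hxy : x < y) :
    Real.Gamma (x + α) * Real.Gamma y < Real.Gamma (y + α) * Real.Gamma x := by
  have h := mul_le_mul_of_rpow_convex (f := Real.Gamma) (fun _ => Real.Gamma_pos_of_pos)
    (fun _ _ _ _ => Real.Gamma_mul_add_mul_le_rpow_Gamma_mul_rpow_Gamma) hα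
    (by linarith : (0 : ℝ) < x + 1) (by linarith : x + 1 < y + 1)
  have hy : 0 < y := hx.trans hxy
  rw [add_right_comm x, add_right_comm y, Real.Gamma_add_one (by positivity),
    Real.Gamma_add_one hy.ne', Real.Gamma_add_one (by positivity),
    Real.Gamma_add_one hx.ne'] at h
  have hpos : 0 < Real.Gamma (x + α) * Real.Gamma y :=
    mul_pos (Real.Gamma_pos_of_pos (by positivity)) (Real.Gamma_pos_of_pos hy)
  have hlt : (y + α) * x < (x + α) * y := by nlinarith
  refine lt_of_mul_lt_mul_left ?_ (by positivity : 0 ≤ (y + α) * x)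
  calc (y + α) * x * (Real.Gamma (x + α) * Real.Gamma y)
      < (x + α) * y * (Real.Gamma (x + α) * Real.Gamma y) := mul_lt_mul_of_pos_right hlt hpos
    _ = (x + α) * Real.Gamma (x + α) * (y * Real.Gamma y) := by ring
    _ ≤ (y + α) * Real.Gamma (y + α) * (x * Real.Gamma x) := h
    _ = (y + α) * x * (Real.Gamma (y + α) * Real.Gamma x) := by ring

/-- For `α > 0` real, `ℓ ≥ 1` an integer and reals `1 < x < y`, one has
`Γ(x+α+ℓ)·ζ(x+α)·Γ(y+ℓ)·ζ(y) < Γ(y+α+ℓ)·ζ(y+α)·Γ(x+ℓ)·ζ(x)`. -/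
theorem zeta_ratio_cross_mul_lt (α : ℝ) (hα : 0 < α) (ℓ : ℕ) (hℓ : 1 ≤ ℓ)
    (x y : ℝ) (hx : 1 < x) (hxy : x < y) :
    Real.Gamma (x + α + ℓ) * zeta (x + α) * (Real.Gamma (y + ℓ) * zeta y) <
      Real.Gamma (y + α + ℓ) * zeta (y + α) * (Real.Gamma (x + ℓ) * zeta x) := by
  have hy : 0 < y := by linarith
  have hG := Gamma_add_mul_Gamma_lt (x := x + ℓ) (y := y + ℓ) hα (by positivity) (by linarith)
  rw [add_right_comm x, add_right_comm y] at hG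
  have hZ := zeta_add_mul_zeta_le hα hx hxy
  have hZ_pos : 0 < zeta (x + α) * zeta y :=
    mul_pos (zeta_pos (by linarith)) (zeta_pos (by linarith))
  have hΓ_nonneg : 0 ≤ Real.Gamma (y + α + ℓ) * Real.Gamma (x + ℓ) :=
    mul_nonneg (Real.Gamma_nonneg_of_nonneg (by positivity))
      (Real.Gamma_nonneg_of_nonneg (by positivity))
  rw [mul_mul_mul_comm, mul_mul_mul_comm (Real.Gamma (y + α + ℓ))]
  exact mul_lt_mul hG hZ hZ_pos hΓ_nonneg
end
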